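/- Let π : GL₂(ℤ/9ℤ) → GL₂(ℤ/3ℤ) be reduction mod 3 and let N be the unique index-6 normal subgroup of GL₂(ℤ/3ℤ). Then the commutator subgroup of π⁻¹(SL₂(ℤ/3ℤ)) equals π⁻¹(N) ∩ SL₂(ℤ/9ℤ), and the abelianization of π⁻¹(SL₂(ℤ/3ℤ)) is isomorphic to ℤ/3ℤ × ℤ/3ℤ. -/

import Mathlib

open Matrix

/-- The set `N ⊆ GL₂(ℤ/3ℤ)` from the paper. -/
def Nset : Set (GL (Fin 2) (ZMod 3)) :=
  {g | (∃ x y : ZMod 3, x ^ 2 + y ^ 2 = 1 ∧ (g : Matrix (Fin 2) (Fin 2) (ZMod 3)) = !![x, -y; y, x]) ∨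
       (∃ x y : ZMod 3, x ^ 2 + y ^ 2 = -1 ∧ (g : Matrix (Fin 2) (Fin 2) (ZMod 3)) = !![x, y; y, -x])}


/-- The reduction map `GL₂(ℤ/9ℤ) → GL₂(ℤ/3ℤ)`. -/
noncomputable def red93 : GL (Fin 2) (ZMod 9) →* GL (Fin 2) (ZMod 3) :=
  Matrix.GeneralLinearGroup.map (ZMod.castHom (by norm_num : (3 : ℕ) ∣ 9) (ZMod 3))

/-- `π⁻¹(SL₂(ℤ/3ℤ)) ⊆ GL₂(ℤ/9ℤ)`. -/
noncomputable def S93 : Subgroup (GL (Fin 2) (ZMod 9)) :=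
  Subgroup.comap red93
    (MonoidHom.ker (Matrix.GeneralLinearGroup.det : GL (Fin 2) (ZMod 3) →* (ZMod 3)ˣ))

namespace Matrix.SpecialLinearGroup

open scoped commutatorElement

/-- The upper unipotent matrix with off-diagonal entry `x`. -/
def upperUnipotent {R : Type*} [CommRing R] (x : R) : SpecialLinearGroup (Fin 2) R :=
  ⟨!![1, x; 0, 1], by simp [det_fin_two]⟩

/-- The lower unipotent matrix with off-diagonal entry `x`. -/
def lowerUnipotent {R : Type*} [CommRing R] (x : R) : SpecialLinearGroup (Fin 2) R :=
  ⟨!![1, 0; x, 1], by simp [det_fin_two]⟩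

@[simp]
theorem coe_upperUnipotent {R : Type*} [CommRing R] (x : R) :
    (upperUnipotent x : Matrix (Fin 2) (Fin 2) R) = !![1, x; 0, 1] := rfl

@[simp]
theorem coe_lowerUnipotent {R : Type*} [CommRing R] (x : R) :
    (lowerUnipotent x : Matrix (Fin 2) (Fin 2) R) = !![1, 0; x, 1] := rfl

/-- The diagonal matrix `diag(2, 5)` of determinant one over `ℤ/9ℤ`. -/
def diagTwoFive : SpecialLinearGroup (Fin 2) (ZMod 9) :=
  ⟨!![2, 0; 0, 5], by decide⟩

theorem upperUnipotent_three_mul_mem_commutator (b : ZMod 9) :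
    upperUnipotent (3 * b) ∈ commutator (SpecialLinearGroup (Fin 2) (ZMod 9)) := by
  have h : ⁅diagTwoFive, upperUnipotent b⁆ = upperUnipotent (3 * b) := by
    revert b; decide
  exact h ▸ Subgroup.commutator_mem_commutator (Subgroup.mem_top _) (Subgroup.mem_top _)

theorem lowerUnipotent_three_mul_mem_commutator (c : ZMod 9) :
    lowerUnipotent (3 * c) ∈ commutator (SpecialLinearGroup (Fin 2) (ZMod 9)) := by
  have h : ⁅diagTwoFive⁻¹, lowerUnipotent c⁆ = lowerUnipotent (3 * c) := by
    revert c; decide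
  exact h ▸ Subgroup.commutator_mem_commutator (Subgroup.mem_top _) (Subgroup.mem_top _)

/-- Reduction `SL₂(ℤ/9ℤ) → SL₂(ℤ/3ℤ)`. -/
def reduceNineThree :
    SpecialLinearGroup (Fin 2) (ZMod 9) →* SpecialLinearGroup (Fin 2) (ZMod 3) :=
  SpecialLinearGroup.map (ZMod.castHom (by norm_num : (3 : ℕ) ∣ 9) (ZMod 3))

theorem exists_eq_add_three_mul_of_cast_eq (p q : ZMod 9)
    (h : (ZMod.cast p : ZMod 3) = ZMod.cast q) : ∃ a, p = q + 3 * a := by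
  revert p q; decide

theorem mem_commutator_of_reduceNineThree_eq_one (s : SpecialLinearGroup (Fin 2) (ZMod 9))
    (hs : reduceNineThree s = 1) : s ∈ commutator (SpecialLinearGroup (Fin 2) (ZMod 9)) := by
  have hentry (i j : Fin 2) : (ZMod.cast (s i j) : ZMod 3) =
      ZMod.cast ((1 : SpecialLinearGroup (Fin 2) (ZMod 9)) i j) := by
    rw [← map_one reduceNineThree] at hs
    exact congr($hs i j)
  have key (i j : Fin 2) := exists_eq_add_three_mul_of_cast_eq _ _ (hentry i j)
  obtain ⟨a, ha⟩ := key 0 0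
  obtain ⟨b, hb⟩ := key 0 1
  obtain ⟨c, hc⟩ := key 1 0
  obtain ⟨d, hd⟩ := key 1 1
  simp only [coe_one, one_apply_eq, ne_eq, zero_ne_one, one_ne_zero, not_false_eq_true,
    one_apply_ne, zero_add] at ha hb hc hd
  have h9 : (9 : ZMod 9) = 0 := rfl
  have hdet := s.det_coe
  rw [det_fin_two, ha, hb, hc, hd] at hdet
  have hfac : s = lowerUnipotent 1 * upperUnipotent (3 * d) * (lowerUnipotent 1)⁻¹ *
      upperUnipotent (3 * (b - d)) * lowerUnipotent (3 * (c + d)) := by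
    refine Subtype.ext ?_
    rw [eta_fin_two s.1, ha, hb, hc, hd]
    simp only [coe_mul, coe_inv, coe_upperUnipotent, coe_lowerUnipotent, adjugate_fin_two_of,
      mul_fin_two]
    congrm !![?_, ?_; ?_, ?_]
    · linear_combination hdet -
        (a * d - b * c + (c + d) * (b - d - 3 * d * (b - d) + d)) * h9
    · linear_combination d * (b - d) * h9
    · linear_combination -((c + d) * (d - 3 * d * (b - d))) * h9
    · linear_combination d * (b - d) * h9
  rw [hfac]
  refine mul_mem (mul_mem ?_ (upperUnipotent_three_mul_mem_commutator _))
    (lowerUnipotent_three_mul_mem_commutator _)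
  exact (inferInstance : (commutator _).Normal).conj_mem _
    (upperUnipotent_three_mul_mem_commutator _) _

theorem lowerUnipotent_mul_upperUnipotent_mem_commutator {R : Type*} [CommRing R] (x : R) :
    lowerUnipotent x * upperUnipotent x ∈ commutator (SpecialLinearGroup (Fin 2) R) := by
  let w : SpecialLinearGroup (Fin 2) R := ⟨!![0, 1; -1, 0], by simp [det_fin_two]⟩
  have hw : (w : Matrix (Fin 2) (Fin 2) R) = !![0, 1; -1, 0] := rfl
  have h : ⁅w, upperUnipotent (-x)⁆ = lowerUnipotent x * upperUnipotent x := by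
    refine Subtype.ext ?_
    simp only [commutatorElement_def, coe_mul, coe_inv, coe_upperUnipotent, coe_lowerUnipotent, hw,
      adjugate_fin_two_of, mul_fin_two]
    congrm !![?_, ?_; ?_, ?_] <;> ring
  exact h ▸ Subgroup.commutator_mem_commutator (Subgroup.mem_top _) (Subgroup.mem_top _)

theorem eq_pow_mul_pow_of_mem_Nset (q : SpecialLinearGroup (Fin 2) (ZMod 3))
    (hq : (q : GL (Fin 2) (ZMod 3)) ∈ Nset) : ∃ m n : ℕ,
      q = (lowerUnipotent 1 * upperUnipotent 1) ^ m *
        (lowerUnipotent (-1) * upperUnipotent (-1)) ^ n := by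
  have h1 : ∀ x y : ZMod 3, x ^ 2 + y ^ 2 = 1 → ∃ m : Fin 4, ∃ n : Fin 2,
      !![x, -y; y, x] = ((lowerUnipotent (1 : ZMod 3) * upperUnipotent 1) ^ (m : ℕ) *
        (lowerUnipotent (-1) * upperUnipotent (-1)) ^ (n : ℕ)).1 := by decide
  have h2 : ∀ x y : ZMod 3, x ^ 2 + y ^ 2 = -1 → ∃ m : Fin 4, ∃ n : Fin 2,
      !![x, y; y, -x] = ((lowerUnipotent (1 : ZMod 3) * upperUnipotent 1) ^ (m : ℕ) *
        (lowerUnipotent (-1) * upperUnipotent (-1)) ^ (n : ℕ)).1 := by decide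
  obtain ⟨x, y, hxy, h⟩ | ⟨x, y, hxy, h⟩ := hq
  · obtain ⟨m, n, hmn⟩ := h1 x y hxy
    exact ⟨m, n, Subtype.ext (h.trans hmn)⟩
  · obtain ⟨m, n, hmn⟩ := h2 x y hxy
    exact ⟨m, n, Subtype.ext (h.trans hmn)⟩

theorem mem_commutator_of_reduceNineThree_mem_Nset (s : SpecialLinearGroup (Fin 2) (ZMod 9))
    (hs : (reduceNineThree s : GL (Fin 2) (ZMod 3)) ∈ Nset) :
    s ∈ commutator (SpecialLinearGroup (Fin 2) (ZMod 9)) := by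
  obtain ⟨m, n, h⟩ := eq_pow_mul_pow_of_mem_Nset _ hs
  set t : SpecialLinearGroup (Fin 2) (ZMod 9) := (lowerUnipotent 1 * upperUnipotent 1) ^ m *
        (lowerUnipotent (-1) * upperUnipotent (-1)) ^ n with ht
  have htmem : t ∈ commutator (SpecialLinearGroup (Fin 2) (ZMod 9)) :=
    mul_mem (pow_mem (lowerUnipotent_mul_upperUnipotent_mem_commutator _) _)
      (pow_mem (lowerUnipotent_mul_upperUnipotent_mem_commutator _) _)
  have hU (x : ZMod 9) : reduceNineThree (upperUnipotent x) = upperUnipotent (ZMod.cast x) := by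
    revert x; decide
  have hL (x : ZMod 9) : reduceNineThree (lowerUnipotent x) = lowerUnipotent (ZMod.cast x) := by
    revert x; decide
  have htred : reduceNineThree t = reduceNineThree s := by
    rw [h, ht]
    simp only [map_mul, map_pow, hU, hL]
    rfl
  refine (Subgroup.mul_mem_cancel_right _ (inv_mem htmem)).1
    (mem_commutator_of_reduceNineThree_eq_one (s * t⁻¹) ?_)
  rw [map_mul, map_inv, htred, mul_inv_cancel]

end Matrix.SpecialLinearGroup

open Matrix.SpecialLinearGroup

theorem mem_S93_iff (g : GL (Fin 2) (ZMod 9)) :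
    g ∈ S93 ↔ (red93 g).1.det = 1 := by
  simp [S93, Subgroup.mem_comap, MonoidHom.mem_ker, Units.ext_iff]

theorem coe_mem_S93 (s : SpecialLinearGroup (Fin 2) (ZMod 9)) :
    (s : GL (Fin 2) (ZMod 9)) ∈ S93 :=
  (mem_S93_iff _).2 (reduceNineThree s).2

theorem coe_mem_commutator_S93 {s : SpecialLinearGroup (Fin 2) (ZMod 9)}
    (hs : s ∈ commutator (SpecialLinearGroup (Fin 2) (ZMod 9))) :
    (s : GL (Fin 2) (ZMod 9)) ∈ ⁅S93, S93⁆ := by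
  have h : (commutator (SpecialLinearGroup (Fin 2) (ZMod 9))).map toGL ≤ ⁅S93, S93⁆ := by
    rw [commutator_def, Subgroup.map_commutator]
    refine Subgroup.commutator_mono ?_ ?_ <;>
    · rintro _ ⟨t, -, rfl⟩
      exact coe_mem_S93 t
  exact h (Subgroup.mem_map_of_mem _ hs)

theorem mem_commutator_S93 {g : GL (Fin 2) (ZMod 9)} (hred : red93 g ∈ Nset)
    (hdet : g.1.det = 1) : g ∈ ⁅S93, S93⁆ := by
  let s : SpecialLinearGroup (Fin 2) (ZMod 9) := ⟨g.1, hdet⟩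
  have hg : (s : GL (Fin 2) (ZMod 9)) = g := Units.ext rfl
  rw [← hg]
  refine coe_mem_commutator_S93 (mem_commutator_of_reduceNineThree_mem_Nset _ ?_)
  convert hred using 1
  exact Units.ext rfl

/-- The character `SL₂(ℤ/3ℤ) → ℤ/3ℤ`, as a function of the matrix. -/
def cubicCharacter (A : Matrix (Fin 2) (Fin 2) (ZMod 3)) : ZMod 3 :=
  (A 0 0 + A 1 1) * A 1 0 - A 0 1 * A 1 1 * (A 1 0 ^ 2 - 1)

theorem cubicCharacter_mul {A B : Matrix (Fin 2) (Fin 2) (ZMod 3)}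
    (hA : A.det = 1) (hB : B.det = 1) :
    cubicCharacter (A * B) = cubicCharacter A + cubicCharacter B := by
  rw [det_fin_two] at hA hB
  simp only [cubicCharacter, mul_apply, Fin.sum_univ_two]
  generalize A 0 0 = a, A 0 1 = b, A 1 0 = c, A 1 1 = d at *
  generalize B 0 0 = e, B 0 1 = f, B 1 0 = g, B 1 1 = h at *
  revert e f g h
  revert a b c d
  decide +kernel

theorem mem_Nset_iff {g : GL (Fin 2) (ZMod 3)} (hg : g.1.det = 1) :
    g ∈ Nset ↔ cubicCharacter g.1 = 0 := by
  have key : ∀ a b c d : ZMod 3, a * d - b * c = 1 →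
      (((∃ x y : ZMod 3, x ^ 2 + y ^ 2 = 1 ∧ !![a, b; c, d] = !![x, -y; y, x]) ∨
        (∃ x y : ZMod 3, x ^ 2 + y ^ 2 = -1 ∧ !![a, b; c, d] = !![x, y; y, -x])) ↔
      (a + d) * c - b * d * (c ^ 2 - 1) = 0) := by
    decide +kernel
  rw [det_fin_two] at hg
  have := key _ _ _ _ hg
  rwa [← eta_fin_two] at this

/-- The isomorphism from the kernel of `(ℤ/9ℤ)ˣ → (ℤ/3ℤ)ˣ` to `ℤ/3ℤ` sending `1 + 3k` to `k`,
as a function on `ℤ/9ℤ`. -/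
def principalUnitLog (u : ZMod 9) : ZMod 3 := (u.val / 3 : ℕ)

theorem principalUnitLog_mul {u v : ZMod 9} (hu : (ZMod.cast u : ZMod 3) = 1)
    (hv : (ZMod.cast v : ZMod 3) = 1) :
    principalUnitLog (u * v) = principalUnitLog u + principalUnitLog v := by
  revert u v; decide

theorem principalUnitLog_eq_zero_iff {u : ZMod 9} (hu : (ZMod.cast u : ZMod 3) = 1) :
    principalUnitLog u = 0 ↔ u = 1 := by
  revert u; decide

theorem cast_det_eq_one {g : GL (Fin 2) (ZMod 9)} (hg : g ∈ S93) :
    (ZMod.cast g.1.det : ZMod 3) = 1 := by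
  rw [mem_S93_iff] at hg
  rw [← hg]
  exact RingHom.map_det (ZMod.castHom (by norm_num : (3 : ℕ) ∣ 9) (ZMod 3)) g.1

/-- The map `S93 → (ℤ/3ℤ)²` whose components come from the cubic character of `SL₂(ℤ/3ℤ)` and the
determinant. -/
noncomputable def S93Characters : S93 →* Multiplicative (ZMod 3) × Multiplicative (ZMod 3) :=
  MonoidHom.mk' (fun g ↦ (Multiplicative.ofAdd (cubicCharacter (red93 g).1),
    Multiplicative.ofAdd (principalUnitLog g.1.1.det))) fun g h ↦ by
      refine Prod.ext ?_ ?_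
      · simpa [← ofAdd_add] using
          cubicCharacter_mul ((mem_S93_iff _).1 g.2) ((mem_S93_iff _).1 h.2)
      · simpa [← ofAdd_add] using
          principalUnitLog_mul (cast_det_eq_one g.2) (cast_det_eq_one h.2)

theorem mem_ker_S93Characters_iff (g : S93) :
    g ∈ S93Characters.ker ↔ red93 g ∈ Nset ∧ g.1.1.det = 1 := by
  rw [mem_Nset_iff ((mem_S93_iff _).1 g.2), ← principalUnitLog_eq_zero_iff (cast_det_eq_one g.2)]
  simp [S93Characters, MonoidHom.mem_ker, Prod.ext_iff]

theorem ker_S93Characters : S93Characters.ker = commutator S93 := by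
  refine le_antisymm (fun g hg ↦ ?_) (Abelianization.commutator_subset_ker _)
  obtain ⟨hN, hdet⟩ := (mem_ker_S93Characters_iff g).1 hg
  have := mem_commutator_S93 hN hdet
  rw [← Subgroup.map_subtype_commutator] at this
  simpa using this

theorem S93Characters_surjective : Function.Surjective S93Characters := by
  rintro ⟨x, y⟩
  have hunit (y : ZMod 3) : (1 + 3 * ZMod.cast y : ZMod 9) * (1 - 3 * ZMod.cast y) = 1 := by
    revert y; decide
  have hlog (y : ZMod 3) : principalUnitLog (1 + 3 * ZMod.cast y) = y := by
    revert y; decide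
  have hred (x y : ZMod 3) : (!![1, ZMod.cast x; 0, 1 + 3 * ZMod.cast y] :
      Matrix (Fin 2) (Fin 2) (ZMod 9)).map (ZMod.cast : ZMod 9 → ZMod 3) = !![1, x; 0, 1] := by
    revert x y; decide
  obtain ⟨x, rfl⟩ := Multiplicative.ofAdd.surjective x
  obtain ⟨y, rfl⟩ := Multiplicative.ofAdd.surjective y
  let A : Matrix (Fin 2) (Fin 2) (ZMod 9) := !![1, ZMod.cast x; 0, 1 + 3 * ZMod.cast y]
  have hdet : A.det = 1 + 3 * ZMod.cast y := by simp [A, det_fin_two]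
  let g : GL (Fin 2) (ZMod 9) :=
    GeneralLinearGroup.mk'' A (hdet ▸ IsUnit.of_mul_eq_one _ (hunit y))
  have hg : (red93 g).1 = !![1, x; 0, 1] := hred x y
  refine ⟨⟨g, (mem_S93_iff g).2 (by rw [hg]; simp [det_fin_two])⟩, Prod.ext ?_ ?_⟩
  · change Multiplicative.ofAdd (cubicCharacter (red93 g).1) = _
    rw [hg]
    simp [cubicCharacter]
  · change Multiplicative.ofAdd (principalUnitLog A.det) = _
    rw [hdet, hlog]

theorem commutator_and_abelianization_of_preimage_SL2
    (N : Subgroup (GL (Fin 2) (ZMod 3)))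
    (hN : (N : Set (GL (Fin 2) (ZMod 3))) = Nset) :
    ⁅S93, S93⁆ = Subgroup.comap red93 N ⊓
        MonoidHom.ker (Matrix.GeneralLinearGroup.det : GL (Fin 2) (ZMod 9) →* (ZMod 9)ˣ) ∧
    Nonempty (Abelianization S93 ≃*
        Multiplicative (ZMod 3) × Multiplicative (ZMod 3)) := by
  refine ⟨le_antisymm ?_ ?_, ?_⟩
  · rw [← Subgroup.map_subtype_commutator, ← ker_S93Characters]
    rintro _ ⟨g, hg, rfl⟩
    obtain ⟨h, hdet⟩ := (mem_ker_S93Characters_iff g).1 hg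
    exact ⟨hN.ge h, Units.ext hdet⟩
  · rintro g ⟨h, hdet⟩
    exact mem_commutator_S93 (hN.le h) congr(($hdet).1)
  · exact ⟨(QuotientGroup.quotientMulEquivOfEq ker_S93Characters.symm).trans
      (QuotientGroup.quotientKerEquivOfSurjective _ S93Characters_surjective)⟩
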